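/- arXiv:1103.2882 — 8 statements merged into one kernel-verified Lean document; each statement's English description precedes it below -/
import Mathlib

section
/- Let 𝒳 be a finite alphabet, P a probability mass function on 𝒳 with P(x) > 0 for all x, 𝒮 an arbitrary set of strategies, ℓ : 𝒳 × 𝒮 → ℝ a loss function, and α > 0. For s ∈ 𝒮 define Z(s) = Σ_{x∈𝒳} P(x)·exp(α·ℓ(x,s)). Suppose s* ∈ 𝒮 and Q* is the probability mass function Q*(x) = P(x)·exp(α·ℓ(x,s*))/Z(s*), and suppose s* minimizes Σ_{x∈𝒳} Q*(x)·ℓ(x,s) over all s ∈ 𝒮. Then s* minimizes Z(s) over all s ∈ 𝒮, i.e., Z(s*) ≤ Z(s) for every s ∈ 𝒮. -/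
open scoped BigOperators

/-- Theorem 1 of the paper (finite-alphabet form): if `s*` minimizes the expected
loss under the exponentially tilted distribution `Q*`, then `s*` minimizes the
exponential moment `Z(s) = Σ_x P(x) exp(α ℓ(x,s))`. -/
theorem exp_moment_optimality
    (𝒳 : Type) [Fintype 𝒳] (𝒮 : Type)
    (P : 𝒳 → ℝ) (hPpos : ∀ x, 0 < P x) (hPsum : ∑ x, P x = 1)
    (ℓ : 𝒳 → 𝒮 → ℝ) (α : ℝ) (hα : 0 < α)
    (Z : 𝒮 → ℝ) (hZ : ∀ s, Z s = ∑ x, P x * Real.exp (α * ℓ x s))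
    (sstar : 𝒮) (Qstar : 𝒳 → ℝ)
    (hQstar : ∀ x, Qstar x = P x * Real.exp (α * ℓ x sstar) / Z sstar)
    (hmin : ∀ s : 𝒮, ∑ x, Qstar x * ℓ x sstar ≤ ∑ x, Qstar x * ℓ x s) :
    ∀ s : 𝒮, Z sstar ≤ Z s := by
  intro s
  have : Nonempty 𝒳 := by
    by_contra h
    rw [not_nonempty_iff] at h
    simp at hPsum
  have hZpos : 0 < Z sstar := by
    rw [hZ]
    exact Finset.sum_pos (fun x _ => mul_pos (hPpos x) (Real.exp_pos _)) Finset.univ_nonempty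
  have tangent (x : 𝒳) : P x * Real.exp (α * ℓ x sstar) +
      α * Z sstar * (Qstar x * ℓ x s - Qstar x * ℓ x sstar) ≤ P x * Real.exp (α * ℓ x s) := by
    have hQ : Z sstar * Qstar x = P x * Real.exp (α * ℓ x sstar) := by
      rw [hQstar, mul_div_cancel₀ _ hZpos.ne']
    calc
      _ = P x * Real.exp (α * ℓ x sstar) * (α * ℓ x s - α * ℓ x sstar + 1) := by
        linear_combination α * (ℓ x s - ℓ x sstar) * hQ
      _ ≤ P x * Real.exp (α * ℓ x sstar) * Real.exp (α * ℓ x s - α * ℓ x sstar) :=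
        mul_le_mul_of_nonneg_left (Real.add_one_le_exp _)
          (mul_pos (hPpos x) (Real.exp_pos _)).le
      _ = P x * Real.exp (α * ℓ x s) := by
        rw [mul_assoc, ← Real.exp_add, add_sub_cancel]
  have hsum := Finset.sum_le_sum fun x (_ : x ∈ Finset.univ) => tangent x
  rw [Finset.sum_add_distrib, ← Finset.mul_sum, Finset.sum_sub_distrib, ← hZ, ← hZ] at hsum
  have hgap := mul_nonneg (mul_pos hα hZpos).le (sub_nonneg.2 (hmin s))
  linarith
end

section
/- Let 𝒳 be a finite alphabet, P a probability mass function on 𝒳 with P(x) > 0 for all x, 𝒮 a set of strategies, ℓ : 𝒳 × 𝒮 → ℝ, and α > 0. Let s₀ ∈ 𝒮, define Q₀(x) = P(x)·exp(−α·ℓ(x,s₀)) / Σ_{x'} P(x')·exp(−α·ℓ(x',s₀)), and let s₁ ∈ 𝒮 minimize Σ_{x∈𝒳} Q₀(x)·ℓ(x,s) over s ∈ 𝒮. Then Σ_{x∈𝒳} P(x)·exp(−α·ℓ(x,s₁)) ≥ Σ_{x∈𝒳} P(x)·exp(−α·ℓ(x,s₀)); i.e., each step of the alternating-minimization iteration does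 not decrease the negative exponential moment. -/
open scoped BigOperators

/-- One step of the alternating-minimization iteration does not decrease the
negative exponential moment: if `Q₀` is the tilted distribution for `s₀` and `s₁`
minimizes `Σ_x Q₀(x) ℓ(x,s)` over `s`, then
`Σ_x P(x) exp(−α ℓ(x,s₁)) ≥ Σ_x P(x) exp(−α ℓ(x,s₀))`. -/
theorem alternating_minimization_improves
    (𝒳 : Type) [Fintype 𝒳] (𝒮 : Type)
    (P : 𝒳 → ℝ) (hPpos : ∀ x, 0 < P x) (hPsum : ∑ x, P x = 1)
    (ℓ : 𝒳 → 𝒮 → ℝ) (α : ℝ) (hα : 0 < α)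
    (s₀ s₁ : 𝒮) (Q₀ : 𝒳 → ℝ)
    (hQ₀ : ∀ x, Q₀ x =
      P x * Real.exp (-α * ℓ x s₀) / ∑ x', P x' * Real.exp (-α * ℓ x' s₀))
    (hs₁ : ∀ s : 𝒮, ∑ x, Q₀ x * ℓ x s₁ ≤ ∑ x, Q₀ x * ℓ x s) :
    ∑ x, P x * Real.exp (-α * ℓ x s₁) ≥ ∑ x, P x * Real.exp (-α * ℓ x s₀) := by
  set Z := ∑ x, P x * Real.exp (-α * ℓ x s₀) with hZ
  have hterm : ∀ x, 0 < P x * Real.exp (-α * ℓ x s₀) := fun x =>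
    mul_pos (hPpos x) (Real.exp_pos _)
  have hne : (Finset.univ : Finset 𝒳).Nonempty :=
    Finset.nonempty_of_sum_ne_zero (hPsum.trans_ne one_ne_zero)
  have hZpos : 0 < Z := Finset.sum_pos (fun x _ => hterm x) hne
  have hZQ : ∀ x, Z * Q₀ x = P x * Real.exp (-α * ℓ x s₀) := fun x => by
    rw [hQ₀ x, mul_div_cancel₀ _ hZpos.ne']
  have hpoint : ∀ x, P x * Real.exp (-α * ℓ x s₀) +
      Z * α * (Q₀ x * ℓ x s₀ - Q₀ x * ℓ x s₁) ≤ P x * Real.exp (-α * ℓ x s₁) := fun x => by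
    have hexp : Real.exp (-α * ℓ x s₁) =
        Real.exp (-α * ℓ x s₀) * Real.exp (α * (ℓ x s₀ - ℓ x s₁)) := by
      rw [← Real.exp_add]
      ring_nf
    calc _ = P x * Real.exp (-α * ℓ x s₀) * (α * (ℓ x s₀ - ℓ x s₁) + 1) := by
          rw [← hZQ x]
          ring
      _ ≤ P x * Real.exp (-α * ℓ x s₀) * Real.exp (α * (ℓ x s₀ - ℓ x s₁)) :=
          mul_le_mul_of_nonneg_left (Real.add_one_le_exp _) (hterm x).le
      _ = _ := by rw [hexp, mul_assoc]
  have hsum := Finset.sum_le_sum fun x (_ : x ∈ Finset.univ) => hpoint x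
  rw [Finset.sum_add_distrib, ← Finset.mul_sum, Finset.sum_sub_distrib, ← hZ] at hsum
  have hgain := mul_nonneg (mul_pos hZpos hα).le (sub_nonneg.mpr (hs₁ s₀))
  linarith
end

section
/- Let 𝒳 be a finite alphabet, P a probability mass function on 𝒳 with P(x) > 0 for all x, 𝒮 a set of strategies, ℓ : 𝒳 × 𝒮 → ℝ, and α > 0; set f(s,Q) = α·Σ_{x} Q(x)·ℓ(x,s) − D(Q‖P) and Z(s) = Σ_x P(x)·exp(α·ℓ(x,s)). Assume the minimax equality min_{s∈𝒮} max_Q f(s,Q) = max_Q min_{s∈𝒮} f(s,Q) holds, where Q ranges over probability mass functions on 𝒳 and all the indicated extrema are attained. Then for any s* that minimizes Z(s) over 𝒮, the tilted distribution Q*(x) = P(x)·exp(α·ℓ(x,s*))/Z(s*) satisfies: s* minimizes Σ_x Q*(x)·ℓ(x,s) over s ∈ 𝒮. In other words, under the minimax equality the conditions of Theorem 1 are also necessary for optimality. -/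
open scoped BigOperators

theorem sub_lt_mul_log_div {q r : ℝ} (hq : 0 ≤ q) (hr : 0 < r) (hne : q ≠ r) :
    q - r < q * Real.log (q / r) := by
  rcases hq.eq_or_lt with rfl | hq
  · simpa using hr
  · have hlt := Real.log_lt_sub_one_of_pos (div_pos hr hq)
      (fun h => hne ((div_eq_one_iff_eq hq.ne').1 h).symm)
    have hmul := mul_lt_mul_of_pos_left hlt hq
    have hlog : Real.log (q / r) = -Real.log (r / q) := by
      rw [← Real.log_inv, inv_div]
    have hcancel : q * (r / q - 1) = r - q := by field_simp
    rw [hlog]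
    linarith

theorem sub_le_mul_log_div {q r : ℝ} (hq : 0 ≤ q) (hr : 0 < r) :
    q - r ≤ q * Real.log (q / r) := by
  rcases eq_or_ne q r with rfl | hne
  · simp [div_self hr.ne']
  · exact (sub_lt_mul_log_div hq hr hne).le

/-- Gibbs' inequality. -/
theorem sum_mul_log_div_nonneg {ι : Type*} [Fintype ι] {Q R : ι → ℝ}
    (hQ : ∀ x, 0 ≤ Q x) (hR : ∀ x, 0 < R x) (hsum : ∑ x, Q x = ∑ x, R x) :
    0 ≤ ∑ x, Q x * Real.log (Q x / R x) := by
  calc (0 : ℝ) = ∑ x, (Q x - R x) := by rw [Finset.sum_sub_distrib, hsum, sub_self]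
    _ ≤ _ := Finset.sum_le_sum fun x _ => sub_le_mul_log_div (hQ x) (hR x)

/-- The equality case of Gibbs' inequality. -/
theorem eq_of_sum_mul_log_div_nonpos {ι : Type*} [Fintype ι] {Q R : ι → ℝ}
    (hQ : ∀ x, 0 ≤ Q x) (hR : ∀ x, 0 < R x) (hsum : ∑ x, Q x = ∑ x, R x)
    (h : ∑ x, Q x * Real.log (Q x / R x) ≤ 0) : Q = R := by
  by_contra hne
  obtain ⟨y, hy⟩ := Function.ne_iff.1 hne
  have hlt : ∑ x, (Q x - R x) < ∑ x, Q x * Real.log (Q x / R x) :=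
    Finset.sum_lt_sum (fun x _ => sub_le_mul_log_div (hQ x) (hR x))
      ⟨y, Finset.mem_univ y, sub_lt_mul_log_div (hQ y) (hR y) hy⟩
  rw [Finset.sum_sub_distrib, hsum, sub_self] at hlt
  exact hlt.not_ge h

/-- The Gibbs variational identity: the defect in the Donsker–Varadhan inequality is the
relative entropy with respect to the tilted distribution. -/
theorem sum_mul_sub_sum_mul_log_div_eq {ι : Type*} [Fintype ι] {P Q : ι → ℝ} (g : ι → ℝ) {z : ℝ}
    (hP : ∀ x, 0 < P x) (hz : 0 < z) (hQ : ∀ x, 0 ≤ Q x) (hQsum : ∑ x, Q x = 1) :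
    ∑ x, Q x * g x - ∑ x, Q x * Real.log (Q x / P x) =
      Real.log z - ∑ x, Q x * Real.log (Q x / (P x * Real.exp (g x) / z)) := by
  have key : ∀ x, Q x * Real.log (Q x / (P x * Real.exp (g x) / z)) =
      Q x * Real.log (Q x / P x) - Q x * g x + Q x * Real.log z := by
    intro x
    rcases (hQ x).eq_or_lt with h | h
    · simp [← h]
    · have hdiv : Q x / (P x * Real.exp (g x) / z) = Q x / P x / Real.exp (g x) * z := by
        have := (hP x).ne'
        field_simp
      have hpos := div_pos h (hP x)
      rw [hdiv, Real.log_mul (div_pos hpos (Real.exp_pos _)).ne' hz.ne',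
        Real.log_div hpos.ne' (Real.exp_pos _).ne', Real.log_exp]
      ring
  simp only [key, Finset.sum_add_distrib, Finset.sum_sub_distrib, ← Finset.sum_mul, hQsum]
  ring

/-- Under the minimax equality (min over `s` of max over pmfs `Q` of
`f(s,Q) = α E_Q ℓ(X,s) − D(Q‖P)` equals max over `Q` of min over `s`, with all
indicated extrema attained), the conditions of Theorem 1 are also necessary:
if `s*` minimizes the exponential moment `Z(s)`, then `s*` minimizes
`Σ_x Q*(x) ℓ(x,s)` for the tilted distribution `Q*(x) = P(x) exp(α ℓ(x,s*))/Z(s*)`. -/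
theorem minimax_necessity_of_optimality_conditions
    (𝒳 : Type) [Fintype 𝒳] (𝒮 : Type)
    (P : 𝒳 → ℝ) (hPpos : ∀ x, 0 < P x) (hPsum : ∑ x, P x = 1)
    (ℓ : 𝒳 → 𝒮 → ℝ) (α : ℝ) (hα : 0 < α)
    (f : 𝒮 → (𝒳 → ℝ) → ℝ)
    (hf : ∀ s Q, f s Q =
      α * ∑ x, Q x * ℓ x s - ∑ x, Q x * Real.log (Q x / P x))
    (Z : 𝒮 → ℝ) (hZ : ∀ s, Z s = ∑ x, P x * Real.exp (α * ℓ x s))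
    -- the inner maximum over pmfs `Q` is attained, with value `maxQ s` :
    (maxQ : 𝒮 → ℝ)
    (hmaxQ : ∀ s : 𝒮, IsGreatest
      {v : ℝ | ∃ Q : 𝒳 → ℝ, (∀ x, 0 ≤ Q x) ∧ (∑ x, Q x = 1) ∧ v = f s Q} (maxQ s))
    -- the inner minimum over `s` is attained, with value `minS Q` :
    (minS : (𝒳 → ℝ) → ℝ)
    (hminS : ∀ Q : 𝒳 → ℝ, (∀ x, 0 ≤ Q x) → (∑ x, Q x = 1) →
      IsLeast {v : ℝ | ∃ s : 𝒮, v = f s Q} (minS Q))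
    -- the minimax equality: both outer extrema are attained and equal to `v` :
    (v : ℝ)
    (houterMin : IsLeast {w : ℝ | ∃ s : 𝒮, w = maxQ s} v)
    (houterMax : IsGreatest
      {w : ℝ | ∃ Q : 𝒳 → ℝ, (∀ x, 0 ≤ Q x) ∧ (∑ x, Q x = 1) ∧ w = minS Q} v)
    -- `s*` minimizes the exponential moment, and `Q*` is its tilted distribution :
    (sstar : 𝒮) (hopt : ∀ s : 𝒮, Z sstar ≤ Z s)
    (Qstar : 𝒳 → ℝ)
    (hQstar : ∀ x, Qstar x = P x * Real.exp (α * ℓ x sstar) / Z sstar) :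
    ∀ s : 𝒮, ∑ x, Qstar x * ℓ x sstar ≤ ∑ x, Qstar x * ℓ x s := by
  have hne : (Finset.univ : Finset 𝒳).Nonempty :=
    Finset.nonempty_of_sum_ne_zero (hPsum ▸ one_ne_zero)
  have hZpos : ∀ s, 0 < Z s := fun s => hZ s ▸
    Finset.sum_pos (fun x _ => mul_pos (hPpos x) (Real.exp_pos _)) hne
  set T : 𝒮 → 𝒳 → ℝ := fun s x => P x * Real.exp (α * ℓ x s) / Z s with hT
  have hTpos : ∀ s x, 0 < T s x := fun s x =>
    div_pos (mul_pos (hPpos x) (Real.exp_pos _)) (hZpos s)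
  have hTsum : ∀ s, ∑ x, T s x = 1 := fun s => by
    rw [hT, ← Finset.sum_div, ← hZ, div_self (hZpos s).ne']
  have hfT : ∀ s Q, (∀ x, 0 ≤ Q x) → ∑ x, Q x = 1 →
      f s Q = Real.log (Z s) - ∑ x, Q x * Real.log (Q x / T s x) := fun s Q hQ hQs => by
    rw [hf, ← sum_mul_sub_sum_mul_log_div_eq (fun x => α * ℓ x s) hPpos (hZpos s) hQ hQs,
      Finset.mul_sum]
    simp only [mul_left_comm]
  have hfTself : ∀ s, f s (T s) = Real.log (Z s) := fun s => by
    rw [hfT s _ (fun x => (hTpos s x).le) (hTsum s)]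
    simp [div_self (hTpos s _).ne']
  have hmax : ∀ s, maxQ s = Real.log (Z s) := fun s => by
    apply le_antisymm
    · obtain ⟨Q, hQ, hQs, h⟩ := (hmaxQ s).1
      rw [h, hfT s Q hQ hQs]
      linarith [sum_mul_log_div_nonneg hQ (hTpos s) (hQs.trans (hTsum s).symm)]
    · exact (hmaxQ s).2 ⟨T s, fun x => (hTpos s x).le, hTsum s, (hfTself s).symm⟩
  have hv : v = Real.log (Z sstar) := by
    apply le_antisymm
    · exact houterMin.2 ⟨sstar, (hmax sstar).symm⟩
    · obtain ⟨s, hs⟩ := houterMin.1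
      rw [hs, hmax]
      exact Real.log_le_log (hZpos _) (hopt s)
  obtain ⟨Q, hQ, hQs, hvQ⟩ := houterMax.1
  have hge : ∀ s, v ≤ f s Q := fun s => hvQ ▸ (hminS Q hQ hQs).2 ⟨s, rfl⟩
  have hQT : Q = T sstar := by
    apply eq_of_sum_mul_log_div_nonpos hQ (hTpos sstar) (hQs.trans (hTsum sstar).symm)
    linarith [hge sstar, hfT sstar Q hQ hQs]
  have hQQ : Qstar = Q := hQT ▸ funext hQstar
  intro s
  have hle : f sstar Q ≤ f s Q := by
    have hself := hfTself sstar
    rw [← hQT, ← hv] at hself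
    exact hself ▸ hge s
  rw [hf, hf] at hle
  rw [hQQ]
  exact le_of_mul_le_mul_left (by linarith) hα
end

section
/- Let 𝒳 be a finite alphabet, P a probability mass function on 𝒳 with P(x) > 0 for all x, and α > 0. For every probability mass function s on 𝒳 with s(x) > 0 for all x: Σ_{x∈𝒳} P(x)·s(x)^{−α} ≥ ( Σ_{x∈𝒳} P(x)^{1/(1+α)} )^{1+α}, with equality when s(x) = P(x)^{1/(1+α)} / Σ_{x'∈𝒳} P(x')^{1/(1+α)}. -/
open scoped BigOperators

/-- The tilted form of a summand of the exponential moment, exhibiting it as an `s`-average. -/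
lemma mul_rpow_neg_eq_mul_div_rpow {p s α : ℝ} (hp : 0 < p) (hs : 0 < s) (hα : 0 < α) :
    p * s ^ (-α) = s * (p ^ (1 / (1 + α)) / s) ^ (1 + α) := by
  have hα' : 1 + α ≠ 0 := by positivity
  rw [Real.div_rpow (Real.rpow_nonneg hp.le _) hs.le, ← Real.rpow_mul hp.le,
    one_div_mul_cancel hα', Real.rpow_one, Real.rpow_add hs, Real.rpow_one, Real.rpow_neg hs.le]
  have := Real.rpow_pos_of_pos hs α
  field_simp

/-- Example 1 (lossless data compression): for pmfs `P` (positive) and `s` (positive)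
and `α > 0`, `Σ_x P(x) s(x)^{−α} ≥ (Σ_x P(x)^{1/(1+α)})^{1+α}`, with equality when
`s(x) = P(x)^{1/(1+α)} / Σ_{x'} P(x')^{1/(1+α)}`. -/
theorem lossless_compression_exp_moment
    (𝒳 : Type) [Fintype 𝒳]
    (P : 𝒳 → ℝ) (hPpos : ∀ x, 0 < P x) (hPsum : ∑ x, P x = 1)
    (α : ℝ) (hα : 0 < α)
    (s : 𝒳 → ℝ) (hspos : ∀ x, 0 < s x) (hssum : ∑ x, s x = 1) :
    (∑ x, P x * s x ^ (-α) ≥ (∑ x, P x ^ (1 / (1 + α))) ^ (1 + α)) ∧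
    ((∀ x, s x = P x ^ (1 / (1 + α)) / ∑ x', P x' ^ (1 / (1 + α))) →
      ∑ x, P x * s x ^ (-α) = (∑ x, P x ^ (1 / (1 + α))) ^ (1 + α)) := by
  have htilt : ∑ x, P x * s x ^ (-α) = ∑ x, s x * (P x ^ (1 / (1 + α)) / s x) ^ (1 + α) :=
    Finset.sum_congr rfl fun x _ => mul_rpow_neg_eq_mul_div_rpow (hPpos x) (hspos x) hα
  rw [htilt]
  refine ⟨?_, fun hs => ?_⟩
  · have hmean : ∑ x, s x * (P x ^ (1 / (1 + α)) / s x) = ∑ x, P x ^ (1 / (1 + α)) :=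
      Finset.sum_congr rfl fun x _ => mul_div_cancel₀ _ (hspos x).ne'
    rw [← hmean]
    exact Real.rpow_arith_mean_le_arith_mean_rpow Finset.univ s _ (fun x _ => (hspos x).le) hssum
      (fun x _ => div_nonneg (Real.rpow_nonneg (hPpos x).le _) (hspos x).le) (by linarith)
  · have hratio (x : 𝒳) :
        P x ^ (1 / (1 + α)) / s x = ∑ x', P x' ^ (1 / (1 + α)) := by
      rw [hs x, div_div_cancel₀ (Real.rpow_pos_of_pos (hPpos x) _).ne']
    simp_rw [hratio]
    rw [← Finset.sum_mul, hssum, one_mul]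
end

section
/- Let ν be a probability measure on ℝ, let φ : ℝ → ℝ be measurable, and let (X,Y) be a random pair whose joint distribution is given by Y ∼ ν and, conditionally on Y = y, X Gaussian with mean φ(y) and variance 1 (i.e., the joint law has density (1/√(2π))·exp(−(x−φ(y))²/2) with respect to dx ⊗ ν(dy)). Then for every α ∈ (0, 1/2) and every measurable function s : ℝ → ℝ: E[ exp( α·(X − s(Y))² ) ] ≥ E[ exp( α·(X − φ(Y))² ) ] = (1 − 2α)^{−1/2}. That is, the conditional-mean estimator s(y) = φ(y) minimizes every exponential moment of the squared error among all (possibly nonlinear) estimators. -/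
open MeasureTheory Real

/-- Exponential moment of the squared distance from `c` to a unit-variance Gaussian with mean `m`. -/
lemma lintegral_gaussian_mul_exp_sq {α : ℝ} (hα : α < 1 / 2) (m c : ℝ) :
    ∫⁻ x : ℝ, ENNReal.ofReal ((Real.sqrt (2 * π))⁻¹ * Real.exp (-(x - m) ^ 2 / 2)) *
        ENNReal.ofReal (Real.exp (α * (x - c) ^ 2)) =
      ENNReal.ofReal ((1 - 2 * α) ^ (-(1 : ℝ) / 2) *
        Real.exp (α * (m - c) ^ 2 / (1 - 2 * α))) := by
  have hb : 0 < 1 / 2 - α := by linarith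
  have hb' : 0 < 1 - 2 * α := by linarith
  set K := (Real.sqrt (2 * π))⁻¹ * Real.exp (α * (m - c) ^ 2 / (1 - 2 * α)) with hK
  set a := m + 2 * α * (m - c) / (1 - 2 * α) with ha
  have h_eq : ∀ x : ℝ, ENNReal.ofReal ((Real.sqrt (2 * π))⁻¹ * Real.exp (-(x - m) ^ 2 / 2)) *
      ENNReal.ofReal (Real.exp (α * (x - c) ^ 2)) =
      ENNReal.ofReal (K * Real.exp (-(1 / 2 - α) * (x - a) ^ 2)) := by
    intro x
    rw [← ENNReal.ofReal_mul (by positivity), mul_assoc, hK, mul_assoc, ← Real.exp_add,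
      ← Real.exp_add]
    congr 3
    rw [ha]
    field_simp
    ring
  have h_int : Integrable fun x : ℝ => K * Real.exp (-(1 / 2 - α) * (x - a) ^ 2) :=
    ((integrable_exp_neg_mul_sq hb).comp_sub_right a).const_mul K
  simp_rw [h_eq]
  rw [← ofReal_integral_eq_lintegral_ofReal h_int (ae_of_all _ fun x => by positivity),
    integral_const_mul,
    integral_sub_right_eq_self (fun x : ℝ => Real.exp (-(1 / 2 - α) * x ^ 2)) a,
    integral_gaussian]
  congr 1
  have h_sqrt : √(π / (1 / 2 - α)) = √(2 * π) * (1 - 2 * α) ^ (-(1 : ℝ) / 2) := by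
    rw [show π / (1 / 2 - α) = 2 * π / (1 - 2 * α) by field_simp,
      Real.sqrt_div (by positivity), neg_div, Real.rpow_neg hb'.le, ← Real.sqrt_eq_rpow,
      div_eq_mul_inv]
  have h_ne : √(2 * π) ≠ 0 := by positivity
  rw [h_sqrt, hK]
  field_simp

/-- Disintegration of the exponential moment of `X - s(Y)` along `Y`. -/
lemma lintegral_exp_sq_withDensity_gaussian (ν : Measure ℝ) [SFinite ν]
    {φ s : ℝ → ℝ} (hφ : Measurable φ) (hs : Measurable s) {α : ℝ} (hα : α < 1 / 2) :
    ∫⁻ p : ℝ × ℝ, ENNReal.ofReal (Real.exp (α * (p.1 - s p.2) ^ 2))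
        ∂((volume.prod ν).withDensity fun p =>
          ENNReal.ofReal ((Real.sqrt (2 * π))⁻¹ * Real.exp (-(p.1 - φ p.2) ^ 2 / 2))) =
      ∫⁻ y, ENNReal.ofReal ((1 - 2 * α) ^ (-(1 : ℝ) / 2) *
        Real.exp (α * (φ y - s y) ^ 2 / (1 - 2 * α))) ∂ν := by
  rw [lintegral_withDensity_eq_lintegral_mul _ (by fun_prop) (by fun_prop),
    lintegral_prod_symm _ (by fun_prop)]
  exact lintegral_congr fun y => lintegral_gaussian_mul_exp_sq hα (φ y) (s y)

/-- Example 2 of the paper: if the joint law `μ` of `(X, Y)` has density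
`(1/√(2π)) exp(−(x−φ(y))²/2)` with respect to `dx ⊗ ν(dy)` (so `Y ∼ ν` and,
given `Y = y`, `X` is Gaussian with mean `φ(y)` and unit variance), then for every
`α ∈ (0, 1/2)` and every measurable estimator `s`,
`E[exp(α (X − s(Y))²)] ≥ E[exp(α (X − φ(Y))²)] = (1 − 2α)^{−1/2}`.
Expectations are formalized as lower integrals, so they may be infinite. -/
theorem conditional_mean_minimizes_exp_moments
    (ν : Measure ℝ) [IsProbabilityMeasure ν]
    (φ : ℝ → ℝ) (hφ : Measurable φ)
    (μ : Measure (ℝ × ℝ))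
    (hμ : μ = (volume.prod ν).withDensity fun p =>
      ENNReal.ofReal ((Real.sqrt (2 * π))⁻¹ * Real.exp (-(p.1 - φ p.2) ^ 2 / 2)))
    (α : ℝ) (hα : α ∈ Set.Ioo (0 : ℝ) (1 / 2))
    (s : ℝ → ℝ) (hs : Measurable s) :
    (∫⁻ p : ℝ × ℝ, ENNReal.ofReal (Real.exp (α * (p.1 - s p.2) ^ 2)) ∂μ ≥
      ∫⁻ p : ℝ × ℝ, ENNReal.ofReal (Real.exp (α * (p.1 - φ p.2) ^ 2)) ∂μ) ∧
    ∫⁻ p : ℝ × ℝ, ENNReal.ofReal (Real.exp (α * (p.1 - φ p.2) ^ 2)) ∂μ =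
      ENNReal.ofReal ((1 - 2 * α) ^ (-(1 : ℝ) / 2)) := by
  have h_value : ∫⁻ p : ℝ × ℝ, ENNReal.ofReal (Real.exp (α * (p.1 - φ p.2) ^ 2)) ∂μ =
      ENNReal.ofReal ((1 - 2 * α) ^ (-(1 : ℝ) / 2)) := by
    rw [hμ, lintegral_exp_sq_withDensity_gaussian ν hφ hφ hα.2]
    simp
  refine ⟨?_, h_value⟩
  have hb : 0 < 1 - 2 * α := by linarith [hα.2]
  have hα₀ : 0 < α := hα.1
  rw [h_value, hμ, lintegral_exp_sq_withDensity_gaussian ν hφ hs hα.2, ge_iff_le]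
  calc ENNReal.ofReal ((1 - 2 * α) ^ (-(1 : ℝ) / 2))
      = ∫⁻ _, ENNReal.ofReal ((1 - 2 * α) ^ (-(1 : ℝ) / 2)) ∂ν := by simp
    _ ≤ _ := lintegral_mono fun y => ENNReal.ofReal_le_ofReal <|
      le_mul_of_one_le_right (by positivity) (Real.one_le_exp (by positivity))
end

section
/- Let n ≥ 1 and σ² > 0. For θ ∈ ℝ let P_θ denote the n-fold product of the Gaussian measure N(θ, σ²) on ℝⁿ. Let s : ℝⁿ → ℝ be a measurable estimator that is unbiased, i.e., ∫ s dP_θ = θ for every θ ∈ ℝ. Then for every α ≥ 0 with 2ασ² < n and every θ ∈ ℝ: ∫ exp( α·(s(x) − θ)² ) dP_θ(x) ≥ (1 − 2ασ²/n)^{−1/2}, and equality holds for the sample mean s(x) = (1/n)·Σ_{i=1}^n x_i. That is, the sample mean minimizes every exponential moment of the squared error among all unbiased estimators of θ. -/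
open MeasureTheory ProbabilityTheory
open scoped BigOperators ENNReal NNReal

/-- Exponential tilting shifts the mean of a real Gaussian measure. -/
lemma gaussianReal_withDensity_exp (μ : ℝ) (v : ℝ≥0) (t : ℝ) :
    (gaussianReal μ v).withDensity
        (fun x ↦ ENNReal.ofReal (Real.exp (t * (x - μ) - v * t ^ 2 / 2))) =
      gaussianReal (μ + v * t) v := by
  by_cases hv : v = 0
  · subst hv
    rw [gaussianReal_zero_var, withDensity_congr_ae (g := 1), withDensity_one]
    · simp
    · rw [Filter.EventuallyEq, ae_dirac_eq]
      simp
  · rw [gaussianReal_of_var_ne_zero _ hv, gaussianReal_of_var_ne_zero _ hv,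
      ← withDensity_mul _ (by fun_prop) (by fun_prop)]
    congr 1
    ext x
    simp only [Pi.mul_apply, gaussianPDF]
    rw [← ENNReal.ofReal_mul (gaussianPDFReal_nonneg _ _ _)]
    congr 1
    have hv' : (v : ℝ) ≠ 0 := by simpa using hv
    rw [gaussianPDFReal, gaussianPDFReal, mul_assoc, ← Real.exp_add]
    congr 2
    field_simp
    ring

/-- A product density with respect to a product measure yields the product of the measures
with densities. -/
lemma pi_withDensity_prod {ι : Type*} [Fintype ι] {X : Type*} [MeasurableSpace X]
    (μ : ι → Measure X) [∀ i, IsProbabilityMeasure (μ i)] (f : ι → X → ℝ≥0∞)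
    (hf : ∀ i, Measurable (f i)) [∀ i, SigmaFinite ((μ i).withDensity (f i))] :
    (Measure.pi μ).withDensity (fun x ↦ ∏ i, f i (x i)) =
      Measure.pi fun i ↦ (μ i).withDensity (f i) := by
  symm
  refine Measure.pi_eq fun s hs ↦ ?_
  rw [withDensity_apply _ (MeasurableSet.univ_pi hs),
    ← lintegral_indicator (MeasurableSet.univ_pi hs)]
  have hg : ∀ i, Measurable ((s i).indicator (f i)) := fun i ↦ (hf i).indicator (hs i)
  calc ∫⁻ x, (Set.univ.pi s).indicator (fun x ↦ ∏ i, f i (x i)) x ∂Measure.pi μ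
      = ∫⁻ x, ∏ i, (s i).indicator (f i) (x i) ∂Measure.pi μ := by
        refine lintegral_congr fun x ↦ ?_
        by_cases hx : x ∈ Set.univ.pi s
        · rw [Set.indicator_of_mem hx]
          exact Finset.prod_congr rfl fun i _ ↦
            (Set.indicator_of_mem (hx i (Set.mem_univ i)) _).symm
        · rw [Set.indicator_of_notMem hx]
          obtain ⟨i, hi⟩ : ∃ i, x i ∉ s i := by simpa [Set.mem_pi] using hx
          exact (Finset.prod_eq_zero (Finset.mem_univ i) (Set.indicator_of_notMem hi _)).symm
    _ = ∏ i, ∫⁻ x, (s i).indicator (f i) (x i) ∂Measure.pi μ :=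
        lintegral_prod_eq_prod_lintegral_of_indepFun Finset.univ
          (fun i (x : ι → X) ↦ (s i).indicator (f i) (x i))
          (iIndepFun_pi fun i ↦ (hg i).aemeasurable)
          (fun i ↦ (hg i).comp (measurable_pi_apply i))
    _ = ∏ i, (μ i).withDensity (f i) (s i) := by
        refine Finset.prod_congr rfl fun i _ ↦ ?_
        rw [(measurePreserving_eval μ i).lintegral_comp (hg i),
          lintegral_indicator (hs i), withDensity_apply _ (hs i)]

/-- Exponential tilting by the centred sum shifts all the means of a product of equal
Gaussian measures. -/
lemma pi_gaussianReal_withDensity_exp {n : ℕ} (μ : ℝ) (v : ℝ≥0) (t : ℝ) :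
    (Measure.pi fun _ : Fin n ↦ gaussianReal μ v).withDensity
        (fun x ↦ ENNReal.ofReal (Real.exp (t * ∑ i, (x i - μ) - n * (v * t ^ 2 / 2)))) =
      Measure.pi fun _ : Fin n ↦ gaussianReal (μ + v * t) v := by
  have : ∀ _ : Fin n, SigmaFinite ((gaussianReal μ v).withDensity
      (fun x ↦ ENNReal.ofReal (Real.exp (t * (x - μ) - v * t ^ 2 / 2)))) := fun _ ↦ by
    rw [gaussianReal_withDensity_exp]; infer_instance
  have h := pi_withDensity_prod (fun _ : Fin n ↦ gaussianReal μ v)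
    (fun _ x ↦ ENNReal.ofReal (Real.exp (t * (x - μ) - v * t ^ 2 / 2))) (fun _ ↦ by fun_prop)
  simp only [gaussianReal_withDensity_exp] at h
  rw [← h]
  congr 1
  ext x
  rw [← ENNReal.ofReal_prod_of_nonneg (fun _ _ ↦ (Real.exp_pos _).le), ← Real.exp_sum,
    Finset.sum_sub_distrib (fun i ↦ t * (x i - μ)), ← Finset.mul_sum]
  simp

/-- The centred sample mean of `n` independent Gaussian observations is Gaussian. -/
lemma map_sampleMean_sub_pi_gaussianReal {n : ℕ} (hn : n ≠ 0) (μ : ℝ) (v : ℝ≥0) :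
    (Measure.pi fun _ : Fin n ↦ gaussianReal μ v).map (fun x ↦ (∑ i, x i) / n - μ) =
      gaussianReal 0 (v / n) := by
  have hsum : (Measure.pi fun _ : Fin n ↦ gaussianReal μ v).map (fun x ↦ ∑ i, x i) =
      gaussianReal (n * μ) (n * v) := by
    refine Measure.ext_of_charFun ?_
    rw [charFun_map_sum_pi_eq_prod]
    ext t
    simp only [Finset.prod_const, Finset.card_univ, Fintype.card_fin, Pi.pow_apply,
      charFun_gaussianReal, ← Complex.exp_nat_mul]
    congr 1
    push_cast
    ring
  have hn' : (n : ℝ) ≠ 0 := by exact_mod_cast hn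
  have hcomp : (fun x : Fin n → ℝ ↦ (∑ i, x i) / n - μ) =
      (fun y : ℝ ↦ y / n - μ) ∘ fun x : Fin n → ℝ ↦ ∑ i, x i := rfl
  have hcomp' : (fun y : ℝ ↦ y / n - μ) = (fun y ↦ y - μ) ∘ fun y ↦ y / n := rfl
  rw [hcomp, ← Measure.map_map (by fun_prop) (by fun_prop), hsum, hcomp',
    ← Measure.map_map (by fun_prop) (by fun_prop), gaussianReal_map_div_const,
    gaussianReal_map_sub_const]
  congr 1
  · field_simp; ring
  · ext
    simp
    field_simp

/-- Tilting a centred Gaussian measure by the exponential of a square rescales it. -/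
lemma lintegral_exp_sq_mul_gaussianReal (w : ℝ≥0) (hw : w ≠ 0) (α : ℝ) (hα : 2 * α * w < 1)
    (f : ℝ → ℝ≥0∞) (hf : Measurable f) :
    ∫⁻ x, ENNReal.ofReal (Real.exp (α * x ^ 2)) * f x ∂gaussianReal 0 w =
      ENNReal.ofReal ((1 - 2 * α * w) ^ (-(1 : ℝ) / 2)) *
        ∫⁻ x, f x ∂gaussianReal 0 (w / (1 - 2 * α * w).toNNReal) := by
  have hc : 0 < 1 - 2 * α * w := by linarith
  have hw0 : (0 : ℝ) < w := by positivity
  have hw' : w / (1 - 2 * α * w).toNNReal ≠ 0 :=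
    div_ne_zero hw (Real.toNNReal_pos.2 hc).ne'
  rw [gaussianReal_of_var_ne_zero _ hw, gaussianReal_of_var_ne_zero _ hw',
    lintegral_withDensity_eq_lintegral_mul _ (by fun_prop) (by fun_prop),
    lintegral_withDensity_eq_lintegral_mul _ (by fun_prop) hf,
    ← lintegral_const_mul _ (by fun_prop)]
  refine lintegral_congr fun x ↦ ?_
  simp only [Pi.mul_apply, ← mul_assoc, gaussianPDF]
  rw [← ENNReal.ofReal_mul (gaussianPDFReal_nonneg _ _ _), ← ENNReal.ofReal_mul (by positivity)]
  congr 2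
  rw [gaussianPDFReal, gaussianPDFReal, mul_assoc, ← Real.exp_add, ← mul_assoc]
  simp only [NNReal.coe_div, Real.coe_toNNReal _ hc.le]
  congr 1
  · rw [neg_div, Real.rpow_neg hc.le, ← Real.sqrt_eq_rpow, ← mul_inv,
      ← Real.sqrt_mul hc.le]
    congr 2
    have hc' : 1 - 2 * w * α ≠ 0 := by linarith
    field_simp
  · congr 1
    field_simp
    ring

/-- Integration against an exponentially tilted centred Gaussian measure. -/
lemma integral_mul_exp_gaussianReal (w : ℝ≥0) (m : ℝ) (g : ℝ → ℝ) :
    ∫ x, g x * Real.exp (x * m) ∂gaussianReal 0 w =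
      Real.exp (w / 2 * m ^ 2) * ∫ x, g x ∂gaussianReal (w * m) w := by
  have h := gaussianReal_withDensity_exp 0 w m
  rw [zero_add] at h
  rw [← h, integral_withDensity_eq_integral_toReal_smul (by fun_prop) (by simp),
    ← integral_const_mul]
  refine integral_congr_ae (.of_forall fun x ↦ ?_)
  simp only [smul_eq_mul]
  rw [ENNReal.toReal_ofReal (Real.exp_pos _).le, mul_comm (g x), ← mul_assoc, ← Real.exp_add]
  congr 2
  ring

lemma integrable_mul_exp_gaussianReal (w : ℝ≥0) (m : ℝ) :
    Integrable (fun x ↦ x * Real.exp (x * m)) (gaussianReal 0 w) := by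
  have h := gaussianReal_withDensity_exp 0 w m
  rw [zero_add] at h
  have hi : Integrable (fun x : ℝ ↦ x) (gaussianReal (w * m) w) :=
    (memLp_id_gaussianReal 1).integrable (by simp)
  rw [← h, integrable_withDensity_iff (by fun_prop) (by simp)] at hi
  refine (hi.mul_const (Real.exp (w / 2 * m ^ 2))).congr (.of_forall fun x ↦ ?_)
  simp only
  rw [ENNReal.toReal_ofReal (Real.exp_pos _).le, mul_assoc, ← Real.exp_add]
  congr 2
  ring

lemma integral_abs_gaussianReal_le (w : ℝ≥0) (m : ℝ) :
    ∫ x, |x| ∂gaussianReal m w ≤ ∫ x, |x| ∂gaussianReal 0 w + |m| := by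
  have hi : Integrable (fun x : ℝ ↦ x) (gaussianReal 0 w) :=
    (memLp_id_gaussianReal 1).integrable (by simp)
  have h : gaussianReal m w = (gaussianReal 0 w).map (· + m) := by
    rw [gaussianReal_map_add_const, zero_add]
  rw [h, integral_map (by fun_prop) (by fun_prop)]
  calc ∫ x, |x + m| ∂gaussianReal 0 w ≤ ∫ x, (|x| + |m|) ∂gaussianReal 0 w :=
        integral_mono (hi.add (integrable_const m)).abs (hi.abs.add (integrable_const _))
          fun x ↦ abs_add_le x m
    _ = _ := by rw [integral_add hi.abs (integrable_const _)]; simp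

/-- If `u` is orthogonal to every exponential `exp (l * m)`, it is orthogonal to
`m * exp (w / 2 * m ^ 2)`. -/
lemma integral_mul_exp_sq_eq_zero {Ω : Type*} [MeasurableSpace Ω] (P : Measure Ω)
    [IsFiniteMeasure P] (u m : Ω → ℝ) (hu : Measurable u) (hm : Measurable m) (w : ℝ≥0)
    (hi : Integrable (fun x ↦ u x * Real.exp (w / 2 * m x ^ 2)) P)
    (him : Integrable (fun x ↦ u x * m x * Real.exp (w / 2 * m x ^ 2)) P)
    (h0 : ∀ l : ℝ, ∫ x, u x * Real.exp (l * m x) ∂P = 0) :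
    ∫ x, w * (u x * m x * Real.exp (w / 2 * m x ^ 2)) ∂P = 0 := by
  have hprod : Integrable (Function.uncurry fun x l ↦ u x * (l * Real.exp (l * m x)))
      (P.prod (gaussianReal 0 w)) := by
    rw [integrable_prod_iff (by
      refine Measurable.aestronglyMeasurable ?_
      unfold Function.uncurry
      fun_prop)]
    refine ⟨.of_forall fun x ↦ (integrable_mul_exp_gaussianReal w (m x)).const_mul (u x), ?_⟩
    simp only [Function.uncurry, norm_mul, Real.norm_eq_abs, Real.abs_exp]
    refine ((hi.norm.mul_const (∫ l, |l| ∂gaussianReal 0 w)).add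
      (him.norm.const_mul (w : ℝ))).mono' ?_ (.of_forall fun x ↦ ?_)
    · refine (StronglyMeasurable.integral_prod_right (f := fun x l ↦
        |u x| * (|l| * Real.exp (l * m x))) ?_).aestronglyMeasurable
      refine Measurable.stronglyMeasurable ?_
      unfold Function.uncurry
      fun_prop
    · rw [integral_const_mul, integral_mul_exp_gaussianReal, norm_mul, norm_mul]
      simp only [Real.norm_eq_abs, abs_abs, Real.abs_exp, Pi.add_apply, norm_mul]
      rw [abs_of_nonneg (integral_nonneg fun x ↦ abs_nonneg x)]
      have h1 := integral_abs_gaussianReal_le w (w * m x)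
      rw [abs_mul, NNReal.abs_eq] at h1
      have h2 := mul_le_mul_of_nonneg_left h1
        (mul_nonneg (abs_nonneg (u x)) (Real.exp_pos (w / 2 * m x ^ 2)).le)
      linarith
  have hswap := integral_integral_swap hprod
  have hL : ∀ x, ∫ l, u x * (l * Real.exp (l * m x)) ∂gaussianReal 0 w =
      w * (u x * m x * Real.exp (w / 2 * m x ^ 2)) := fun x ↦ by
    rw [integral_const_mul, integral_mul_exp_gaussianReal w (m x) fun l ↦ l,
      integral_id_gaussianReal]
    ring
  have hR : ∀ l, ∫ x, u x * (l * Real.exp (l * m x)) ∂P = 0 := fun l ↦ by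
    rw [← mul_zero l, ← h0 l, ← integral_const_mul]
    congr 1
    ext x
    ring
  simpa only [hL, hR, integral_zero] using hswap

lemma exp_mul_sq_tangent (α a b : ℝ) :
    Real.exp (α * b ^ 2) * (1 + α * a ^ 2 - α * b ^ 2) ≤ Real.exp (α * a ^ 2) := by
  have h := mul_le_mul_of_nonneg_left (Real.add_one_le_exp (α * a ^ 2 - α * b ^ 2))
    (Real.exp_pos (α * b ^ 2)).le
  rw [← Real.exp_add] at h
  ring_nf at h ⊢
  exact h

/-- A Gaussian statistic `m` minimizes the exponential moments of the square among all `t` such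
that `t - m` is orthogonal to every exponential of `m`. -/
lemma le_lintegral_exp_sq {Ω : Type*} [MeasurableSpace Ω] (P : Measure Ω)
    [IsProbabilityMeasure P] (t m : Ω → ℝ) (ht : Measurable t) (hm : Measurable m)
    (w : ℝ≥0) (hw : w ≠ 0) (hlaw : P.map m = gaussianReal 0 w)
    (h0 : ∀ l : ℝ, ∫ x, (t x - m x) * Real.exp (l * m x) ∂P = 0)
    (α : ℝ) (hα : 0 ≤ α) (hαw : 2 * α * w < 1) :
    ∫⁻ x, ENNReal.ofReal (Real.exp (α * m x ^ 2)) ∂P ≤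
      ∫⁻ x, ENNReal.ofReal (Real.exp (α * t x ^ 2)) ∂P := by
  rcases hα.eq_or_lt with rfl | hα0
  · simp
  by_cases hfin : ∫⁻ x, ENNReal.ofReal (Real.exp (α * t x ^ 2)) ∂P = ∞
  · simp [hfin]
  have hit : Integrable (fun x ↦ Real.exp (α * t x ^ 2)) P := by
    refine (lintegral_ofReal_ne_top_iff_integrable (by fun_prop)
      (.of_forall fun x ↦ (Real.exp_pos _).le)).1 hfin
  have hgauss : ∀ f : ℝ → ℝ, Measurable f → (∀ x, 0 ≤ f x) →
      Integrable f (gaussianReal 0 (w / (1 - 2 * α * w).toNNReal)) →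
      Integrable (fun x ↦ Real.exp (α * m x ^ 2) * f (m x)) P := by
    intro f hf hf0 hfi
    refine (lintegral_ofReal_ne_top_iff_integrable (by fun_prop)
      (.of_forall fun x ↦ mul_nonneg (Real.exp_pos _).le (hf0 _))).1 ?_
    simp_rw [ENNReal.ofReal_mul (Real.exp_pos _).le]
    rw [← lintegral_map (f := fun y ↦ ENNReal.ofReal (Real.exp (α * y ^ 2)) * ENNReal.ofReal (f y))
      (by fun_prop) hm, hlaw, lintegral_exp_sq_mul_gaussianReal w hw α hαw _ (by fun_prop)]
    refine ENNReal.mul_ne_top ENNReal.ofReal_ne_top ?_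
    exact (lintegral_ofReal_ne_top_iff_integrable (by fun_prop) (.of_forall hf0)).2 hfi
  have him0 : Integrable (fun x ↦ Real.exp (α * m x ^ 2)) P := by
    simpa using hgauss (fun _ ↦ 1) (by fun_prop) (by simp) (integrable_const _)
  have him2 : Integrable (fun x ↦ Real.exp (α * m x ^ 2) * m x ^ 2) P :=
    hgauss (fun x ↦ x ^ 2) (by fun_prop) (fun x ↦ sq_nonneg x)
      (memLp_id_gaussianReal 2).integrable_sq
  have hit2 : Integrable (fun x ↦ Real.exp (α * m x ^ 2) * t x ^ 2) P := by
    refine ((hit.add (him2.const_mul α)).const_mul α⁻¹).mono' (by fun_prop)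
      (.of_forall fun x ↦ ?_)
    rw [Real.norm_of_nonneg (by positivity), le_inv_mul_iff₀ hα0]
    have h1 := exp_mul_sq_tangent α (t x) (m x)
    have h2 := Real.exp_pos (α * m x ^ 2)
    simp only [Pi.add_apply]
    linarith
  have hmaj := (him0.add (hit2.add him2)).const_mul 2
  have hu : Integrable (fun x ↦ (t x - m x) * Real.exp (α * m x ^ 2)) P := by
    refine hmaj.mono' (by fun_prop) (.of_forall fun x ↦ ?_)
    simp only [Pi.add_apply, norm_mul, Real.norm_eq_abs, Real.abs_exp]
    have h1 : |t x - m x| ≤ 2 * (1 + (t x ^ 2 + m x ^ 2)) :=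
      abs_le.2 ⟨by nlinarith [sq_nonneg (t x + 1), sq_nonneg (m x - 1)],
        by nlinarith [sq_nonneg (t x - 1), sq_nonneg (m x + 1)]⟩
    have h2 := mul_le_mul_of_nonneg_right h1 (Real.exp_pos (α * m x ^ 2)).le
    linarith
  have hum : Integrable (fun x ↦ (t x - m x) * m x * Real.exp (α * m x ^ 2)) P := by
    refine hmaj.mono' (by fun_prop) (.of_forall fun x ↦ ?_)
    rw [norm_mul]
    simp only [Pi.add_apply, Real.norm_eq_abs, Real.abs_exp]
    have h1 : |(t x - m x) * m x| ≤ 2 * (1 + (t x ^ 2 + m x ^ 2)) :=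
      abs_le.2 ⟨by nlinarith [sq_nonneg (t x + m x), sq_nonneg (m x), sq_nonneg (t x)],
        by nlinarith [sq_nonneg (t x - m x), sq_nonneg (m x), sq_nonneg (t x)]⟩
    have h2 := mul_le_mul_of_nonneg_right h1 (Real.exp_pos (α * m x ^ 2)).le
    linarith
  have hc : (((2 * α).toNNReal : ℝ≥0) : ℝ) = 2 * α := Real.coe_toNNReal _ (by positivity)
  have hc2 : 2 * α / 2 = α := by ring
  have hzero : ∫ x, 2 * α * ((t x - m x) * m x * Real.exp (α * m x ^ 2)) ∂P = 0 := by
    have h := integral_mul_exp_sq_eq_zero P (fun x ↦ t x - m x) m (by fun_prop) hm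
      (2 * α).toNNReal
    simp only [hc, hc2] at h
    exact h hu hum h0
  rw [← ofReal_integral_eq_lintegral_ofReal him0 (.of_forall fun x ↦ (Real.exp_pos _).le),
    ← ofReal_integral_eq_lintegral_ofReal hit (.of_forall fun x ↦ (Real.exp_pos _).le)]
  refine ENNReal.ofReal_le_ofReal ?_
  calc ∫ x, Real.exp (α * m x ^ 2) ∂P
      = ∫ x, (Real.exp (α * m x ^ 2) +
          2 * α * ((t x - m x) * m x * Real.exp (α * m x ^ 2))) ∂P := by
        rw [integral_add him0 (hum.const_mul _), hzero, add_zero]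
    _ ≤ ∫ x, Real.exp (α * t x ^ 2) ∂P := by
        refine integral_mono (him0.add (hum.const_mul _)) hit fun x ↦ ?_
        have h1 := exp_mul_sq_tangent α (t x) (m x)
        have h2 : 0 ≤ Real.exp (α * m x ^ 2) * (α * (t x - m x) ^ 2) := by positivity
        simp only
        linarith

/-- The difference of two unbiased estimators of a Gaussian mean is orthogonal to every
exponential of the centred sample mean. -/
lemma integral_mul_exp_sampleMean_eq_zero {n : ℕ} (hn : n ≠ 0) (v : ℝ≥0)
    (u : (Fin n → ℝ) → ℝ)
    (hu : ∀ θ : ℝ, ∫ x, u x ∂(Measure.pi fun _ : Fin n ↦ gaussianReal θ v) = 0) (θ l : ℝ) :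
    ∫ x, u x * Real.exp (l * ((∑ i, x i) / n - θ))
      ∂(Measure.pi fun _ : Fin n ↦ gaussianReal θ v) = 0 := by
  have hn' : (n : ℝ) ≠ 0 := by exact_mod_cast hn
  have h := hu (θ + v * (l / n))
  rw [← pi_gaussianReal_withDensity_exp,
    integral_withDensity_eq_integral_toReal_smul (by fun_prop) (by simp)] at h
  rw [← mul_zero (Real.exp (n * (v * (l / n) ^ 2 / 2))), ← h, ← integral_const_mul]
  refine integral_congr_ae (.of_forall fun x ↦ ?_)
  simp only [smul_eq_mul]
  rw [ENNReal.toReal_ofReal (Real.exp_pos _).le, ← mul_assoc, ← Real.exp_add, mul_comm (u x)]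
  congr 2
  simp only [Finset.sum_sub_distrib, Finset.sum_const, Finset.card_univ, Fintype.card_fin,
    nsmul_eq_mul]
  field_simp
  ring


/-- Example 3 of the paper: among all unbiased estimators of the mean `θ` of `n`
i.i.d. `N(θ, σ²)` observations, the sample mean minimizes every exponential moment
of the squared error: for any unbiased measurable `s` and `0 ≤ α` with `2ασ² < n`,
`∫ exp(α (s(x) − θ)²) dP_θ ≥ (1 − 2ασ²/n)^{−1/2}`, with equality for the sample
mean. The integral is formalized as a lower integral, so it may be infinite. -/
theorem sample_mean_optimal_unbiased_exp_moment
    (n : ℕ) (hn : 1 ≤ n) (v : ℝ≥0) (hv : 0 < v)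
    (P : ℝ → Measure (Fin n → ℝ))
    (hP : ∀ θ : ℝ, P θ = Measure.pi fun _ : Fin n => gaussianReal θ v)
    (s : (Fin n → ℝ) → ℝ) (hs : Measurable s)
    (hint : ∀ θ : ℝ, Integrable s (P θ))
    (hunbiased : ∀ θ : ℝ, ∫ x, s x ∂(P θ) = θ)
    (α : ℝ) (hα : 0 ≤ α) (hαv : 2 * α * (v : ℝ) < n) (θ : ℝ) :
    (∫⁻ x, ENNReal.ofReal (Real.exp (α * (s x - θ) ^ 2)) ∂(P θ) ≥
      ENNReal.ofReal ((1 - 2 * α * (v : ℝ) / n) ^ (-(1 : ℝ) / 2))) ∧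
    ((∀ x, s x = (∑ i, x i) / n) →
      ∫⁻ x, ENNReal.ofReal (Real.exp (α * (s x - θ) ^ 2)) ∂(P θ) =
        ENNReal.ofReal ((1 - 2 * α * (v : ℝ) / n) ^ (-(1 : ℝ) / 2))) := by

  have hn0 : n ≠ 0 := by omega
  have hn' : (0 : ℝ) < n := by exact_mod_cast hn
  have hprob : ∀ θ, IsProbabilityMeasure (P θ) := fun θ ↦ by rw [hP]; infer_instance
  have hw : v / (n : ℝ≥0) ≠ 0 := div_ne_zero hv.ne' (by exact_mod_cast hn0)
  have hcoe : 2 * α * ((v / (n : ℝ≥0) : ℝ≥0) : ℝ) = 2 * α * v / n := by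
    push_cast
    ring
  have hαw : 2 * α * ((v / (n : ℝ≥0) : ℝ≥0) : ℝ) < 1 := by
    rw [hcoe, div_lt_one hn']
    exact hαv
  have hlaw : ∀ θ, (P θ).map (fun x ↦ (∑ i, x i) / n - θ) = gaussianReal 0 (v / n) := fun θ ↦ by
    rw [hP]
    exact map_sampleMean_sub_pi_gaussianReal hn0 θ v
  have hmean : ∫⁻ x, ENNReal.ofReal (Real.exp (α * ((∑ i, x i) / n - θ) ^ 2)) ∂(P θ) =
      ENNReal.ofReal ((1 - 2 * α * (v : ℝ) / n) ^ (-(1 : ℝ) / 2)) := by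
    have h := lintegral_exp_sq_mul_gaussianReal (v / n) hw α hαw (fun _ ↦ 1) measurable_const
    rw [← hlaw θ, lintegral_map (by fun_prop) (by fun_prop), hcoe] at h
    simpa using h
  refine ⟨?_, fun h ↦ by simpa only [h] using hmean⟩
  have hu : ∀ θ, ∫ x, (s x - (∑ i, x i) / n) ∂(P θ) = 0 := fun θ ↦ by
    have hid : Integrable (fun y : ℝ ↦ y) ((P θ).map fun x ↦ (∑ i, x i) / n - θ) := by
      rw [hlaw]
      exact (memLp_id_gaussianReal 1).integrable (by simp)
    have hmi : Integrable (fun x : Fin n → ℝ ↦ (∑ i, x i) / n - θ) (P θ) :=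
      hid.comp_measurable (by fun_prop)
    have hm0 : ∫ x, ((∑ i, x i) / n - θ) ∂(P θ) = 0 := by
      rw [← integral_map (f := fun y : ℝ ↦ y) (by fun_prop) (by fun_prop), hlaw,
        integral_id_gaussianReal]
    calc ∫ x, (s x - (∑ i, x i) / n) ∂(P θ)
        = ∫ x, ((s x - θ) - ((∑ i, x i) / n - θ)) ∂(P θ) := by
          congr 1
          ext x
          ring
      _ = 0 := by
          rw [integral_sub (f := fun x ↦ s x - θ) ((hint θ).sub (integrable_const θ)) hmi, hm0,
            integral_sub (hint θ) (integrable_const θ), hunbiased]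
          simp
  rw [ge_iff_le, ← hmean]
  refine le_lintegral_exp_sq (P θ) (fun x ↦ s x - θ) (fun x ↦ (∑ i, x i) / n - θ)
    (by fun_prop) (by fun_prop) (v / n) hw (hlaw θ) (fun l ↦ ?_) α hα hαw
  simp only [sub_sub_sub_cancel_right]
  simp only [hP] at hu ⊢
  exact integral_mul_exp_sampleMean_eq_zero hn0 v _ hu θ l
end

section
/- Let 𝒳 be a finite alphabet, P a probability mass function on 𝒳 with P(x) > 0 for all x, α > 0, and n ≥ 1. For x = (x₁,…,xₙ) ∈ 𝒳ⁿ let P̂_x denote the empirical distribution of x (P̂_x(a) = (1/n)·#{i : x_i = a}) and let H(P̂_x) = −Σ_a P̂_x(a)·ln P̂_x(a) be its Shannon entropy in nats. Then Σ_{x∈𝒳ⁿ} ( Π_{i=1}^n P(x_i) ) · exp( α·n·H(P̂_x) ) ≤ ( Σ_{a∈𝒳} P(a)^{1/(1+α)} )^{n(1+α)}; equivalently, (1/n)·ln E_P exp(α·n·Ĥ(X₁,…,Xₙ)) ≤ α·H_{1/(1+α)}(P), where H_u(P) = (1/(1−u))·ln Σ_a P(a)^u is the Rényi entropy of order u. 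-/
open scoped BigOperators

/-- Gibbs' inequality on a finite type. -/
theorem neg_sum_mul_log_le_neg_sum_mul_log {ι : Type*} [Fintype ι] {p q : ι → ℝ}
    (hp : ∀ a, 0 ≤ p a) (hq : ∀ a, 0 < q a) (hqp : ∑ a, q a ≤ ∑ a, p a) :
    -∑ a, p a * Real.log (p a) ≤ -∑ a, p a * Real.log (q a) := by
  have key : ∀ a, p a * Real.log (q a) - p a * Real.log (p a) ≤ q a - p a := by
    intro a
    rcases (hp a).eq_or_lt with h | h
    · simp [← h, (hq a).le]
    · have hlog := Real.log_le_sub_one_of_pos (div_pos (hq a) h)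
      rw [Real.log_div (hq a).ne' h.ne'] at hlog
      calc p a * Real.log (q a) - p a * Real.log (p a)
          = p a * (Real.log (q a) - Real.log (p a)) := by ring
        _ ≤ p a * (q a / p a - 1) := by gcongr
        _ = q a - p a := by field_simp
  have hsum := Finset.sum_le_sum fun a (_ : a ∈ Finset.univ) => key a
  simp only [Finset.sum_sub_distrib] at hsum
  linarith

/-- Summing over values weighted by multiplicity is summing over indices. -/
theorem sum_card_fiber_mul {ι κ : Type*} [Fintype ι] [Fintype κ] [DecidableEq κ]
    (x : ι → κ) (f : κ → ℝ) :
    ∑ a, ((Finset.univ.filter fun i => x i = a).card : ℝ) * f a = ∑ i, f (x i) := by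
  simp only [Finset.card_filter, Nat.cast_sum, Finset.sum_mul]
  rw [Finset.sum_comm]
  simp

/-- The empirical entropy of a sequence, times its length, is at most the ideal code length
of the sequence under any probability mass function of full support. -/
theorem mul_empirical_entropy_le {κ : Type*} [Fintype κ] [DecidableEq κ] {n : ℕ} (hn : 1 ≤ n)
    (x : Fin n → κ) {q : κ → ℝ} (hq : ∀ a, 0 < q a) (hqsum : ∑ a, q a = 1) :
    (n : ℝ) * (- ∑ a,
        (((Finset.univ.filter fun i => x i = a).card : ℝ) / n) *
          Real.log (((Finset.univ.filter fun i => x i = a).card : ℝ) / n)) ≤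
      - ∑ i, Real.log (q (x i)) := by
  have hn0 : (0 : ℝ) < n := by exact_mod_cast hn
  have hsum : ∑ a, ((Finset.univ.filter fun i => x i = a).card : ℝ) / n = 1 := by
    have h := sum_card_fiber_mul x fun _ => (n : ℝ)⁻¹
    simp only [← div_eq_mul_inv] at h
    rw [h]
    simp [hn0.ne']
  refine (mul_le_mul_of_nonneg_left
    (neg_sum_mul_log_le_neg_sum_mul_log (fun a => by positivity) hq (by rw [hqsum, hsum]))
    hn0.le).trans_eq ?_
  rw [← sum_card_fiber_mul x fun a => Real.log (q a), mul_neg, Finset.mul_sum]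
  congr 1
  refine Finset.sum_congr rfl fun a _ => ?_
  field_simp

/-- The tilted distribution `P ^ (1 / (1 + α)) / Z` attains `Z ^ (1 + α)`. -/
theorem sum_mul_tilted_rpow_neg {κ : Type*} [Fintype κ] [Nonempty κ] {P : κ → ℝ}
    (hP : ∀ a, 0 < P a) {α : ℝ} (hα : 0 < α) :
    ∑ a, P a * (P a ^ (1 / (1 + α)) / ∑ b, P b ^ (1 / (1 + α))) ^ (-α) =
      (∑ a, P a ^ (1 / (1 + α))) ^ (1 + α) := by
  have hZ : 0 < ∑ b, P b ^ (1 / (1 + α)) :=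
    Finset.sum_pos (fun b _ => Real.rpow_pos_of_pos (hP b) _) Finset.univ_nonempty
  rw [Real.rpow_add hZ, Real.rpow_one, Finset.sum_mul]
  refine Finset.sum_congr rfl fun a _ => ?_
  have hs : 1 / (1 + α) = 1 + 1 / (1 + α) * (-α) := by field_simp; ring
  rw [Real.div_rpow (Real.rpow_pos_of_pos (hP a) _).le hZ.le, Real.rpow_neg hZ.le, div_inv_eq_mul,
    ← Real.rpow_mul (hP a).le, ← mul_assoc]
  congr 1
  conv_rhs => rw [hs, Real.rpow_add (hP a), Real.rpow_one]

/-- Achievability part of the extension of Rissanen's result (Section 4):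
for an i.i.d. source `P` on a finite alphabet,
`Σ_{x ∈ 𝒳ⁿ} (Π_i P(x_i)) exp(α n H(P̂_x)) ≤ (Σ_a P(a)^{1/(1+α)})^{n(1+α)}`,
where `P̂_x` is the empirical distribution of `x` and `H` its Shannon entropy
(in nats, with `0 · ln 0 = 0`). -/
theorem empirical_entropy_exp_moment_upper_bound
    (𝒳 : Type) [Fintype 𝒳] [DecidableEq 𝒳]
    (P : 𝒳 → ℝ) (hPpos : ∀ x, 0 < P x) (hPsum : ∑ x, P x = 1)
    (α : ℝ) (hα : 0 < α) (n : ℕ) (hn : 1 ≤ n) :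
    ∑ x : Fin n → 𝒳,
        (∏ i, P (x i)) *
          Real.exp (α * n *
            (- ∑ a : 𝒳,
              (((Finset.univ.filter fun i => x i = a).card : ℝ) / n) *
                Real.log (((Finset.univ.filter fun i => x i = a).card : ℝ) / n))) ≤
      (∑ a : 𝒳, P a ^ (1 / (1 + α))) ^ ((n : ℝ) * (1 + α)) := by
  have : Nonempty 𝒳 := by
    by_contra h
    rw [not_nonempty_iff] at h
    simp at hPsum
  have hZ : 0 < ∑ b, P b ^ (1 / (1 + α)) :=
    Finset.sum_pos (fun b _ => Real.rpow_pos_of_pos (hPpos b) _) Finset.univ_nonempty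
  set Q : 𝒳 → ℝ := fun a => P a ^ (1 / (1 + α)) / ∑ b, P b ^ (1 / (1 + α)) with hQ
  have hQpos : ∀ a, 0 < Q a := fun a => div_pos (Real.rpow_pos_of_pos (hPpos a) _) hZ
  have hQsum : ∑ a, Q a = 1 := by rw [hQ, ← Finset.sum_div, div_self hZ.ne']
  calc _ ≤ ∑ x : Fin n → 𝒳, ∏ i, (P (x i) * Q (x i) ^ (-α)) := by
        refine Finset.sum_le_sum fun x _ => ?_
        rw [Finset.prod_mul_distrib]
        refine mul_le_mul_of_nonneg_left ?_ (Finset.prod_nonneg fun i _ => (hPpos _).le)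
        simp only [Real.rpow_def_of_pos (hQpos _), ← Real.exp_sum, ← Finset.sum_mul]
        rw [Real.exp_le_exp, mul_assoc]
        have h := mul_le_mul_of_nonneg_left (mul_empirical_entropy_le hn x hQpos hQsum) hα.le
        linarith
    _ = (∑ a, P a * Q a ^ (-α)) ^ n := by
        rw [Fintype.sum_pow]
    _ = _ := by
        rw [sum_mul_tilted_rpow_neg hPpos hα, mul_comm, Real.rpow_mul hZ.le, Real.rpow_natCast]
end

section
/- Let (Ω, ℱ) be a measurable space, Θ ⊆ ℝ, and {P_θ : θ ∈ Θ} a family of probability measures on Ω. Let θ̂ : Ω → ℝ be a measurable estimator, α > 0, and let θ, θ′ ∈ Θ be such that P_{θ′} is absolutely continuous with respect to P_θ with D(P_{θ′}‖P_θ) < ∞, the estimator is unbiased at θ′ (∫ θ̂ dP_{θ′} = θ′), and ∫ (θ̂ − θ′)² dP_{θ′} < ∞. Then ∫ exp( α·(θ̂ − θ)² ) dP_θ ≥ exp( α·∫ (θ̂ − θ′)² dP_{θ′} + α·(θ − θ′)² − D(P_{θ′}‖P_θ) ). -/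
open MeasureTheory

/-- Jensen's inequality for the exponential, with a possibly infinite right-hand side. -/
theorem ofReal_exp_integral_le_lintegral {Ω : Type*} [MeasurableSpace Ω] {μ : Measure Ω}
    [IsProbabilityMeasure μ] {g : Ω → ℝ} (hg : Integrable g μ) :
    ENNReal.ofReal (Real.exp (∫ x, g x ∂μ)) ≤ ∫⁻ x, ENNReal.ofReal (Real.exp (g x)) ∂μ := by
  have hmeas : AEStronglyMeasurable (fun x => Real.exp (g x)) μ :=
    Real.continuous_exp.comp_aestronglyMeasurable hg.1
  have hnonneg : 0 ≤ᵐ[μ] fun x => Real.exp (g x) := ae_of_all _ fun x => (Real.exp_pos _).le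
  by_cases htop : ∫⁻ x, ENNReal.ofReal (Real.exp (g x)) ∂μ = ⊤
  · simp [htop]
  have hexp : Integrable (fun x => Real.exp (g x)) μ :=
    (lintegral_ofReal_ne_top_iff_integrable hmeas hnonneg).1 htop
  rw [← ofReal_integral_eq_lintegral_ofReal hexp hnonneg]
  exact ENNReal.ofReal_le_ofReal <| convexOn_exp.map_integral_le
    Real.continuous_exp.continuousOn isClosed_univ (by simp) hg hexp

/-- The lower bound in the Donsker–Varadhan variational formula. -/
theorem ofReal_exp_integral_sub_integral_llr_le_lintegral {Ω : Type*} [MeasurableSpace Ω]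
    {μ ν : Measure Ω} [IsProbabilityMeasure μ] [SigmaFinite ν] (hμν : μ ≪ ν)
    (hllr : Integrable (llr μ ν) μ) {f : Ω → ℝ} (hf : Measurable f) (hf_int : Integrable f μ) :
    ENNReal.ofReal (Real.exp (∫ x, f x ∂μ - ∫ x, llr μ ν x ∂μ)) ≤
      ∫⁻ x, ENNReal.ofReal (Real.exp (f x)) ∂ν := by
  rw [← integral_sub hf_int hllr]
  refine (ofReal_exp_integral_le_lintegral (hf_int.sub hllr)).trans ?_
  have hmeas : Measurable fun x => ENNReal.ofReal (Real.exp (f x - llr μ ν x)) :=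
    (hf.sub (measurable_llr μ ν)).exp.ennreal_ofReal
  simp only [Pi.sub_apply]
  rw [← lintegral_rnDeriv_mul hμν hmeas.aemeasurable]
  refine lintegral_mono_ae ?_
  filter_upwards [μ.rnDeriv_ne_top ν] with x hx
  by_cases h0 : μ.rnDeriv ν x = 0
  · simp [h0]
  have hpos : 0 < (μ.rnDeriv ν x).toReal := ENNReal.toReal_pos h0 hx
  have hmul : (μ.rnDeriv ν x).toReal * Real.exp (f x - llr μ ν x) = Real.exp (f x) := by
    rw [Real.exp_sub, llr, Real.exp_log hpos, mul_div_cancel₀ _ hpos.ne']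
  rw [← hmul, ENNReal.ofReal_mul hpos.le, ENNReal.ofReal_toReal hx]

/-- The bias–variance decomposition of the mean square error. -/
theorem integrable_sq_sub_and_integral_sq_sub {Ω : Type*} [MeasurableSpace Ω] {μ : Measure Ω}
    [IsProbabilityMeasure μ] {X : Ω → ℝ} {m : ℝ} (hX : Integrable X μ)
    (hm : ∫ x, X x ∂μ = m) (hX_sq : Integrable (fun x => (X x - m) ^ 2) μ) (c : ℝ) :
    Integrable (fun x => (X x - c) ^ 2) μ ∧
      ∫ x, (X x - c) ^ 2 ∂μ = ∫ x, (X x - m) ^ 2 ∂μ + (c - m) ^ 2 := by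
  have hsub : Integrable (fun x => X x - m) μ := hX.sub (integrable_const m)
  have hlin : Integrable (fun x => 2 * (m - c) * (X x - m)) μ := hsub.const_mul _
  have hsum : Integrable (fun x => (X x - m) ^ 2 + 2 * (m - c) * (X x - m)) μ := hX_sq.add hlin
  have hzero : ∫ x, (X x - m) ∂μ = 0 := by
    rw [integral_sub hX (integrable_const m), hm]
    simp
  have hexpand : (fun x => (X x - c) ^ 2) =
      fun x => (X x - m) ^ 2 + 2 * (m - c) * (X x - m) + (c - m) ^ 2 := by
    funext x
    ring
  rw [hexpand]
  refine ⟨hsum.add (integrable_const _), ?_⟩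
  rw [integral_add hsum (integrable_const _), integral_add hX_sq hlin, integral_const_mul, hzero]
  simp

/-- Section 6 chain of inequalities: by change of measure from `P_θ` to `P_{θ′}` and
Jensen's inequality, for an estimator unbiased at `θ′`,
`∫ exp(α (θ̂ − θ)²) dP_θ ≥ exp(α ∫ (θ̂ − θ′)² dP_{θ′} + α (θ − θ′)² − D(P_{θ′}‖P_θ))`.
The relative entropy is `D(P_{θ′}‖P_θ) = ∫ llr(P_{θ′}, P_θ) dP_{θ′}` and the
left-hand side is formalized as a lower integral (it may be infinite). -/
theorem exp_moment_lower_bound_via_change_of_measure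
    (Ω : Type) [MeasurableSpace Ω] (Θ : Set ℝ)
    (P : ℝ → Measure Ω) (hprob : ∀ ϑ ∈ Θ, IsProbabilityMeasure (P ϑ))
    (est : Ω → ℝ) (hest : Measurable est)
    (α : ℝ) (hα : 0 < α)
    (θ θ' : ℝ) (hθ : θ ∈ Θ) (hθ' : θ' ∈ Θ)
    (hac : P θ' ≪ P θ)
    (hD : Integrable (llr (P θ') (P θ)) (P θ'))
    (hest_int : Integrable est (P θ'))
    (hunbiased : ∫ x, est x ∂(P θ') = θ')
    (hmoment : Integrable (fun x => (est x - θ') ^ 2) (P θ')) :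
    ∫⁻ x, ENNReal.ofReal (Real.exp (α * (est x - θ) ^ 2)) ∂(P θ) ≥
      ENNReal.ofReal (Real.exp
        (α * ∫ x, (est x - θ') ^ 2 ∂(P θ') + α * (θ - θ') ^ 2 -
          ∫ x, llr (P θ') (P θ) x ∂(P θ'))) := by
  have := hprob θ hθ
  have := hprob θ' hθ'
  obtain ⟨hint, heq⟩ := integrable_sq_sub_and_integral_sq_sub hest_int hunbiased hmoment θ
  have hbound := ofReal_exp_integral_sub_integral_llr_le_lintegral hac hD
    (((hest.sub_const θ).pow_const 2).const_mul α) (hint.const_mul α)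
  rwa [integral_const_mul, heq, mul_add] at hbound
end
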